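/- Let n ≥ 1, let α = (α₁,…,αₙ) ∈ (0,π)ⁿ be a vector of non-exceptional angles, let ℓ ∈ (0,∞)ⁿ and σ ∈ ℝ. Then the transfer matrix T(α,ℓ,σ) has the form with rows (pₙ, qₙ) and (conj(qₙ), conj(pₙ)), where pₙ = (∏_{j=1}^n sin(π²/(2α_j)))^{−1} · Σ_{ζ∈{±1}ⁿ, ζ₁=1} 𝔭_ζ(α)·exp(i(ℓ·ζ)σ) and qₙ = −i·(∏_{j=1}^n sin(π²/(2α_j)))^{−1} · Σ_{ζ∈{±1}ⁿ, ζ₁=1} 𝔮_ζ(α)·exp(−i(ℓ·ζ)σ). In particular, pₙ·∏_{j=1}^n sin(π²/(2α_j)) = F_even(α,ℓ,σ) + i·F_odd(α,ℓ,σ). (This is Theorem 7.1 together with Proposition 7.2 of the paper, giving explicit formulas for the entries of T.) -/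

import Mathlib

open Matrix

/-- The vertex transfer matrix `A(α)` (for non-exceptional `α`). -/
noncomputable def Amat (α : ℝ) : Matrix (Fin 2) (Fin 2) ℂ :=
  !![((Real.sin (Real.pi ^ 2 / (2 * α)))⁻¹ : ℂ),
      -Complex.I * ((Real.cos (Real.pi ^ 2 / (2 * α)) / Real.sin (Real.pi ^ 2 / (2 * α)) : ℝ) : ℂ);
      Complex.I * ((Real.cos (Real.pi ^ 2 / (2 * α)) / Real.sin (Real.pi ^ 2 / (2 * α)) : ℝ) : ℂ),
      ((Real.sin (Real.pi ^ 2 / (2 * α)))⁻¹ : ℂ)]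

/-- The side transfer matrix `B(ℓ,σ) = diag(exp(iℓσ), exp(-iℓσ))`. -/
noncomputable def Bmat (ℓ σ : ℝ) : Matrix (Fin 2) (Fin 2) ℂ :=
  !![Complex.exp (Complex.I * ((ℓ * σ : ℝ) : ℂ)), 0;
      0, Complex.exp (-(Complex.I * ((ℓ * σ : ℝ) : ℂ)))]

/-- `C(α,ℓ,σ) = A(α) · B(ℓ,σ)`. -/
noncomputable def Cmat (α ℓ σ : ℝ) : Matrix (Fin 2) (Fin 2) ℂ := Amat α * Bmat ℓ σ

/-- The transfer matrix `T(α,ℓ,σ) = C(αₙ,ℓₙ,σ) ⋯ C(α₁,ℓ₁,σ)`. -/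
noncomputable def Tmat {n : ℕ} (α ℓ : Fin n → ℝ) (σ : ℝ) : Matrix (Fin 2) (Fin 2) ℂ :=
  ((List.ofFn fun j => Cmat (α j) (ℓ j) σ).reverse).prod

/-- An angle is exceptional if it is of the form `π/(2k)` for a positive integer `k`. -/
def Exceptional (α : ℝ) : Prop := ∃ k : ℕ, 0 < k ∧ α = Real.pi / (2 * (k : ℝ))

/-- Cyclic successor on `Fin n`. -/
def cyc {n : ℕ} (j : Fin n) : Fin n :=
  ⟨(j.val + 1) % n, Nat.mod_lt _ (Nat.lt_of_le_of_lt (Nat.zero_le _) j.isLt)⟩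

/-- The sign vector `ζ ∈ {±1}ⁿ` encoded by `ε : Fin n → Bool`. -/
def sgnB {n : ℕ} (ε : Fin n → Bool) (j : Fin n) : ℝ := if ε j then 1 else -1

/-- Sign vectors `ζ ∈ {±1}ⁿ` with `ζ₁ = 1`. -/
def zSet (n : ℕ) : Finset (Fin n → Bool) :=
  Finset.univ.filter fun ε => ∀ j : Fin n, (j : ℕ) = 0 → ε j = true

/-- The dot product `ℓ · ζ`. -/
noncomputable def dotSgn {n : ℕ} (ℓ : Fin n → ℝ) (ε : Fin n → Bool) : ℝ :=
  ∑ j, ℓ j * sgnB ε j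

/-- `𝔭_ζ(α) = ∏_{j ∈ Ch(ζ)} cos(π²/(2α_j))`, where `Ch(ζ)` is the set of indices of sign change
of `ζ`, with the cyclic convention `ζ_{n+1} = ζ₁`. -/
noncomputable def pCoef {n : ℕ} (α : Fin n → ℝ) (ε : Fin n → Bool) : ℝ :=
  ∏ j ∈ Finset.univ.filter (fun j : Fin n => ε j ≠ ε (cyc j)),
    Real.cos (Real.pi ^ 2 / (2 * α j))

/-- The padded successor value: `ζ_{j+1}` where the padding convention `ζ_{n+1} := -1`
(encoded as `false`) is used. -/
def nextPad {n : ℕ} (ε : Fin n → Bool) (j : Fin n) : Bool :=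
  if h : j.val + 1 < n then ε ⟨j.val + 1, h⟩ else false

/-- `𝔮_ζ(α) = ∏_{j ∈ C̃h(ζ)} cos(π²/(2α_j))`, where `C̃h(ζ)` is the set of indices of sign change
of `ζ` padded by `ζ_{n+1} := -1`. -/
noncomputable def qCoef {n : ℕ} (α : Fin n → ℝ) (ε : Fin n → Bool) : ℝ :=
  ∏ j ∈ Finset.univ.filter (fun j : Fin n => ε j ≠ nextPad ε j),
    Real.cos (Real.pi ^ 2 / (2 * α j))

/-- `F_even(α,ℓ,σ) = Σ_{ζ ∈ {±1}ⁿ, ζ₁ = 1} 𝔭_ζ(α) cos((ℓ·ζ)σ)`. -/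
noncomputable def Feven {n : ℕ} (α ℓ : Fin n → ℝ) (σ : ℝ) : ℝ :=
  ∑ ε ∈ zSet n, pCoef α ε * Real.cos (dotSgn ℓ ε * σ)

/-- `F_odd(α,ℓ,σ) = Σ_{ζ ∈ {±1}ⁿ, ζ₁ = 1} 𝔭_ζ(α) sin((ℓ·ζ)σ)`. -/
noncomputable def Fodd {n : ℕ} (α ℓ : Fin n → ℝ) (σ : ℝ) : ℝ :=
  ∑ ε ∈ zSet n, pCoef α ε * Real.sin (dotSgn ℓ ε * σ)

/-- The entry `pₙ(α,ℓ,σ)` of the transfer matrix `T(α,ℓ,σ)`. -/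
noncomputable def pEntry {n : ℕ} (α ℓ : Fin n → ℝ) (σ : ℝ) : ℂ :=
  (∏ j, ((Real.sin (Real.pi ^ 2 / (2 * α j)) : ℝ) : ℂ))⁻¹ *
    ∑ ε ∈ zSet n, ((pCoef α ε : ℝ) : ℂ) *
      Complex.exp (Complex.I * ((dotSgn ℓ ε * σ : ℝ) : ℂ))

/-- The entry `qₙ(α,ℓ,σ)` of the transfer matrix `T(α,ℓ,σ)`. -/
noncomputable def qEntry {n : ℕ} (α ℓ : Fin n → ℝ) (σ : ℝ) : ℂ :=
  -Complex.I * (∏ j, ((Real.sin (Real.pi ^ 2 / (2 * α j)) : ℝ) : ℂ))⁻¹ *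
    ∑ ε ∈ zSet n, ((qCoef α ε : ℝ) : ℂ) *
      Complex.exp (-(Complex.I * ((dotSgn ℓ ε * σ : ℝ) : ℂ)))

/-- The sign vector `ζ` extended by the final sign `ζ_{n+1} = a`. -/
def padEnd {n : ℕ} (ε : Fin n → Bool) (a : Bool) : Fin (n + 1) → Bool :=
  Fin.snoc (α := fun _ => Bool) ε a

theorem padEnd_cons {n : ℕ} (c : Bool) (ε : Fin n → Bool) (a : Bool) :
    padEnd (Fin.cons c ε : Fin (n + 1) → Bool) a = Fin.cons c (padEnd ε a) :=
  (Fin.cons_snoc_eq_snoc_cons c ε a).symm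

theorem padEnd_succ {n : ℕ} (ε : Fin n → Bool) (a : Bool) (j : Fin n) :
    padEnd ε a j.succ = if h : j.val + 1 < n then ε ⟨j.val + 1, h⟩ else a := by
  simp [padEnd, Fin.snoc, Fin.castLT]

theorem padEnd_zero {n : ℕ} (hn : 0 < n) (ε : Fin n → Bool) (a : Bool) :
    padEnd ε a 0 = ε ⟨0, hn⟩ := by
  simp [padEnd, Fin.snoc, Fin.castLT, hn]

theorem padEnd_not {n : ℕ} (ε : Fin n → Bool) (a : Bool) (j : Fin (n + 1)) :
    padEnd (fun i => !ε i) (!a) j = !padEnd ε a j := by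
  unfold padEnd Fin.snoc
  split_ifs <;> simp

/-- The product of `cos(π²/(2α_j))` over the sign changes of `ζ`, where `ζ_{n+1} = a`. -/
noncomputable def changeCoef {n : ℕ} (α : Fin n → ℝ) (ε : Fin n → Bool) (a : Bool) : ℝ :=
  ∏ j, if ε j ≠ padEnd ε a j.succ then Real.cos (Real.pi ^ 2 / (2 * α j)) else 1

theorem changeCoef_cons {n : ℕ} (α : Fin (n + 1) → ℝ) (c : Bool) (ε : Fin n → Bool) (a : Bool) :
    changeCoef α (Fin.cons c ε : Fin (n + 1) → Bool) a =
      (if c ≠ padEnd ε a 0 then Real.cos (Real.pi ^ 2 / (2 * α 0)) else 1) *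
        changeCoef (fun j => α j.succ) ε a := by
  simp only [changeCoef, Fin.prod_univ_succ, padEnd_cons, Fin.cons_zero, Fin.cons_succ]

theorem changeCoef_not {n : ℕ} (α : Fin n → ℝ) (ε : Fin n → Bool) (a : Bool) :
    changeCoef α (fun i => !ε i) (!a) = changeCoef α ε a := by
  simp only [changeCoef, padEnd_not, ne_eq, Bool.not_inj_iff]

theorem changeCoef_false {n : ℕ} (α : Fin n → ℝ) (ε : Fin n → Bool) :
    changeCoef α ε false = qCoef α ε := by
  simp only [changeCoef, padEnd_succ]
  rw [qCoef, Finset.prod_filter]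
  rfl

theorem changeCoef_true {n : ℕ} (α : Fin n → ℝ) {ε : Fin n → Bool} (hε : ε ∈ zSet n) :
    changeCoef α ε true = pCoef α ε := by
  simp only [changeCoef, pCoef, Finset.prod_filter]
  refine Finset.prod_congr rfl fun j _ => ?_
  have h : padEnd ε true j.succ = ε (cyc j) := by
    rw [padEnd_succ]
    split_ifs with hj
    · simp only [cyc, Nat.mod_eq_of_lt hj]
    · have hjn : j.val + 1 = n := by omega
      exact ((Finset.mem_filter.mp hε).2 (cyc j) (by simp [cyc, hjn])).symm
  rw [h]

theorem dotSgn_cons {n : ℕ} (ℓ : Fin (n + 1) → ℝ) (c : Bool) (ε : Fin n → Bool) :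
    dotSgn ℓ (Fin.cons c ε : Fin (n + 1) → Bool) =
      ℓ 0 * (if c then 1 else -1) + dotSgn (fun j => ℓ j.succ) ε := by
  simp only [dotSgn, sgnB, Fin.sum_univ_succ, Fin.cons_zero, Fin.cons_succ]

theorem dotSgn_not {n : ℕ} (ℓ : Fin n → ℝ) (ε : Fin n → Bool) :
    dotSgn ℓ (fun i => !ε i) = -dotSgn ℓ ε := by
  rw [dotSgn, dotSgn, ← Finset.sum_neg_distrib]
  refine Finset.sum_congr rfl fun j _ => ?_
  cases h : ε j <;> simp [sgnB, h]

/-- The sum of `∏ cos · exp(i(ℓ·ζ)σ)` over the sign vectors `ζ` with `ζ_{n+1} = a`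
and `ζ₁ = b`. -/
noncomputable def pathSum {n : ℕ} (α ℓ : Fin n → ℝ) (σ : ℝ) (a b : Bool) : ℂ :=
  ∑ ε : Fin n → Bool, if padEnd ε a 0 = b then
    (changeCoef α ε a : ℂ) * Complex.exp (Complex.I * ((dotSgn ℓ ε * σ : ℝ) : ℂ)) else 0

theorem pathSum_succ {n : ℕ} (α ℓ : Fin (n + 1) → ℝ) (σ : ℝ) (a b : Bool) :
    pathSum α ℓ σ a b = ∑ k, pathSum (fun j => α j.succ) (fun j => ℓ j.succ) σ a k *
      (((if b ≠ k then Real.cos (Real.pi ^ 2 / (2 * α 0)) else 1 : ℝ) : ℂ) *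
        Complex.exp (Complex.I * ((ℓ 0 * (if b then 1 else -1) * σ : ℝ) : ℂ))) := by
  simp only [pathSum, Finset.sum_mul, ite_mul, zero_mul]
  rw [Finset.sum_comm, ← (Fin.consEquiv fun _ : Fin (n + 1) => Bool).sum_comp,
    Fintype.sum_prod_type_right]
  refine Finset.sum_congr rfl fun ε _ => ?_
  simp only [Fin.consEquiv, Equiv.coe_fn_mk, padEnd_cons, Fin.cons_zero, changeCoef_cons, dotSgn_cons]
  rw [Finset.sum_ite_eq' Finset.univ b, Finset.sum_ite_eq Finset.univ (padEnd ε a 0)]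
  simp only [Finset.mem_univ, if_true, add_mul, Complex.ofReal_add, mul_add, Complex.exp_add,
    Complex.ofReal_mul]
  ring

theorem pathSum_not {n : ℕ} (α ℓ : Fin n → ℝ) (σ : ℝ) (a b : Bool) :
    pathSum α ℓ σ (!a) (!b) = starRingEnd ℂ (pathSum α ℓ σ a b) := by
  have hinv : Function.Involutive fun (ε : Fin n → Bool) i => !ε i := fun ε => by simp
  rw [pathSum, pathSum, ← Equiv.sum_comp hinv.toPerm, map_sum]
  refine Finset.sum_congr rfl fun ε _ => ?_
  simp only [Function.Involutive.coe_toPerm, padEnd_not, changeCoef_not, dotSgn_not,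
    Bool.not_inj_iff, apply_ite (starRingEnd ℂ), map_mul, map_zero,
    Complex.conj_ofReal, ← Complex.exp_conj, Complex.conj_I]
  simp

/-- The matrix index of a sign: `+1` is the first and `-1` the second. -/
def signIndex (a : Bool) : Fin 2 := if a then 0 else 1

/-- The phase of the matrix entry with row sign `a` and column sign `b`. -/
noncomputable def signPhase (a b : Bool) : ℂ :=
  if a = b then 1 else if a then -Complex.I else Complex.I

theorem signPhase_mul (a k b : Bool) : signPhase a k * signPhase k b = signPhase a b := by
  cases a <;> cases k <;> cases b <;> simp [signPhase]

theorem Cmat_apply (α ℓ σ : ℝ) (a b : Bool) :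
    Cmat α ℓ σ (signIndex a) (signIndex b) =
      signPhase a b * ((Real.sin (Real.pi ^ 2 / (2 * α)) : ℝ) : ℂ)⁻¹ *
        (((if b ≠ a then Real.cos (Real.pi ^ 2 / (2 * α)) else 1 : ℝ) : ℂ) *
          Complex.exp (Complex.I * ((ℓ * (if b then 1 else -1) * σ : ℝ) : ℂ))) := by
  cases a <;> cases b <;>
    simp [Cmat, Amat, Bmat, signIndex, signPhase, Matrix.mul_apply, Fin.sum_univ_two] <;> ring

theorem Tmat_succ {n : ℕ} (α ℓ : Fin (n + 1) → ℝ) (σ : ℝ) :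
    Tmat α ℓ σ = Tmat (fun j => α j.succ) (fun j => ℓ j.succ) σ * Cmat (α 0) (ℓ 0) σ := by
  simp [Tmat, List.ofFn_succ]

theorem Tmat_apply {n : ℕ} (α ℓ : Fin n → ℝ) (σ : ℝ) (a b : Bool) :
    Tmat α ℓ σ (signIndex a) (signIndex b) =
      signPhase a b * (∏ j, ((Real.sin (Real.pi ^ 2 / (2 * α j)) : ℝ) : ℂ))⁻¹ *
        pathSum α ℓ σ a b := by
  induction n generalizing b with
  | zero =>
    cases a <;> cases b <;>
      simp [Tmat, signIndex, signPhase, pathSum, padEnd, changeCoef, dotSgn, Fin.snoc]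
  | succ n ih =>
    have hsum (f : Fin 2 → ℂ) : ∑ k, f k = ∑ k, f (signIndex k) := by
      simp [signIndex, Fin.sum_univ_two]
    rw [Tmat_succ, Matrix.mul_apply, hsum, pathSum_succ, Finset.mul_sum]
    refine Finset.sum_congr rfl fun k _ => ?_
    rw [ih, Cmat_apply, Fin.prod_univ_succ, mul_inv, ← signPhase_mul a k b]
    ring

theorem pathSum_apply_true {n : ℕ} (hn : 1 ≤ n) (α ℓ : Fin n → ℝ) (σ : ℝ) (a : Bool) :
    pathSum α ℓ σ a true = ∑ ε ∈ zSet n, (changeCoef α ε a : ℂ) *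
      Complex.exp (Complex.I * ((dotSgn ℓ ε * σ : ℝ) : ℂ)) := by
  rw [pathSum, zSet, Finset.sum_filter]
  refine Finset.sum_congr rfl fun ε _ => ?_
  have h : padEnd ε a 0 = true ↔ ∀ j : Fin n, (j : ℕ) = 0 → ε j = true := by
    rw [padEnd_zero hn]
    refine ⟨fun h j hj => ?_, fun h => h _ rfl⟩
    rwa [show j = ⟨0, hn⟩ from Fin.ext hj]
  simp only [h]

theorem pEntry_eq_pathSum {n : ℕ} (hn : 1 ≤ n) (α ℓ : Fin n → ℝ) (σ : ℝ) :
    pEntry α ℓ σ = (∏ j, ((Real.sin (Real.pi ^ 2 / (2 * α j)) : ℝ) : ℂ))⁻¹ *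
      pathSum α ℓ σ true true := by
  rw [pEntry, pathSum_apply_true hn]
  congr 1
  exact Finset.sum_congr rfl fun ε hε => by rw [changeCoef_true α hε]

theorem qEntry_eq_pathSum {n : ℕ} (hn : 1 ≤ n) (α ℓ : Fin n → ℝ) (σ : ℝ) :
    qEntry α ℓ σ = -Complex.I * (∏ j, ((Real.sin (Real.pi ^ 2 / (2 * α j)) : ℝ) : ℂ))⁻¹ *
      pathSum α ℓ σ true false := by
  rw [qEntry, show pathSum α ℓ σ true false = _ from pathSum_not α ℓ σ false true,
    pathSum_apply_true hn, map_sum]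
  congr 1
  refine Finset.sum_congr rfl fun ε _ => ?_
  rw [changeCoef_false, map_mul, Complex.conj_ofReal, ← Complex.exp_conj, map_mul,
    Complex.conj_ofReal, Complex.conj_I, neg_mul]

theorem sin_ne_zero_of_not_exceptional {α : ℝ} (hα : 0 < α) (h : ¬ Exceptional α) :
    Real.sin (Real.pi ^ 2 / (2 * α)) ≠ 0 := by
  intro hsin
  obtain ⟨k, hk⟩ := Real.sin_eq_zero_iff.mp hsin
  have hπ := Real.pi_pos
  have hkpos : (0 : ℝ) < k := by
    have : 0 < (k : ℝ) * Real.pi := by rw [hk]; positivity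
    exact pos_of_mul_pos_left this hπ.le
  lift k to ℕ using by exact_mod_cast hkpos.le
  simp only [Int.cast_natCast] at hk hkpos
  refine h ⟨k, by exact_mod_cast hkpos, ?_⟩
  field_simp at hk ⊢
  linarith

/-- **Theorem 7.1 and Proposition 7.2.** Explicit formulas for the entries of `T(α,ℓ,σ)`:
`T = !![pₙ, qₙ; conj qₙ, conj pₙ]` with `pₙ` and `qₙ` as above, and
`pₙ · ∏ sin(π²/(2α_j)) = F_even + i F_odd`. -/
theorem stmt13 (n : ℕ) (hn : 1 ≤ n) (α ℓ : Fin n → ℝ)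
    (hα : ∀ j, α j ∈ Set.Ioo 0 Real.pi ∧ ¬ Exceptional (α j))
    (hℓ : ∀ j, 0 < ℓ j) (σ : ℝ) :
    Tmat α ℓ σ =
      !![pEntry α ℓ σ, qEntry α ℓ σ;
          starRingEnd ℂ (qEntry α ℓ σ), starRingEnd ℂ (pEntry α ℓ σ)] ∧
    pEntry α ℓ σ * ∏ j, ((Real.sin (Real.pi ^ 2 / (2 * α j)) : ℝ) : ℂ)
        = ((Feven α ℓ σ : ℝ) : ℂ) + Complex.I * ((Fodd α ℓ σ : ℝ) : ℂ) := by
  have hentry := Tmat_apply α ℓ σ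
  have hconj : starRingEnd ℂ (∏ j, ((Real.sin (Real.pi ^ 2 / (2 * α j)) : ℝ) : ℂ)) =
      ∏ j, ((Real.sin (Real.pi ^ 2 / (2 * α j)) : ℝ) : ℂ) := by
    rw [← Complex.ofReal_prod, Complex.conj_ofReal]
  constructor
  · rw [pEntry_eq_pathSum hn, qEntry_eq_pathSum hn]
    simp only [map_mul, map_inv₀, map_neg, hconj, Complex.conj_I, ← pathSum_not]
    ext i j
    fin_cases i <;> fin_cases j
    · simpa [signIndex, signPhase] using hentry true true
    · simpa [signIndex, signPhase] using hentry true false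
    · simpa [signIndex, signPhase] using hentry false true
    · simpa [signIndex, signPhase] using hentry false false
  · have hsin : ∏ j, ((Real.sin (Real.pi ^ 2 / (2 * α j)) : ℝ) : ℂ) ≠ 0 :=
      Finset.prod_ne_zero_iff.mpr fun j _ => Complex.ofReal_ne_zero.mpr
        (sin_ne_zero_of_not_exceptional (hα j).1.1 (hα j).2)
    rw [pEntry, mul_right_comm, inv_mul_cancel₀ hsin, one_mul, Feven, Fodd, Complex.ofReal_sum,
      Complex.ofReal_sum, Finset.mul_sum, ← Finset.sum_add_distrib]
    refine Finset.sum_congr rfl fun ε _ => ?_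
    rw [mul_comm Complex.I, Complex.exp_mul_I]
    push_cast
    ring
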